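/- Let ξ, φ : ℝ → ℝ be smooth with ξ' > 0 and φ > 0 everywhere. Define Φ : ℝ × (0,∞) × ℝ → ℝ³ by Φ(x,u,p) = ( ξ(x), φ(x)u, (φ'(x)u + φ(x)p)/ξ'(x) ), the first prolongation of the fiber-preserving linear transformation x̄ = ξ(x), ū = φ(x)u. Let ω² be the 1-form on {(x,u,p) : u > 0} given by ω²_{(x,u,p)} = (du − p dx)/u. Then Φ preserves ω²: for every z = (x,u,p) with u > 0 and every vector v ∈ ℝ³ one has ω²_{Φ(z)}( DΦ_z v ) = ω²_z( v ), where DΦ_z is the Fréchet derivative of Φ at z. -/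

import Mathlib

noncomputable section

/-- The space `ℝ³` with coordinates `(x, u, p) = (z 0, z 1, z 2)`. -/
abbrev E3 : Type := Fin 3 → ℝ

/-- The coordinate covector `dx` on `ℝ³`. -/
def dX3 : E3 →L[ℝ] ℝ := ContinuousLinearMap.proj 0
/-- The coordinate covector `du` on `ℝ³`. -/
def dU3 : E3 →L[ℝ] ℝ := ContinuousLinearMap.proj 1

/-- The 1-form `ω² = (du − p dx)/u` on `{u > 0}`. -/
def ω2₃ : E3 → E3 →L[ℝ] ℝ := fun z => (z 1)⁻¹ • (dU3 - z 2 • dX3)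

/-- The first prolongation `Φ(x,u,p) = (ξ(x), φ(x)u, (φ'(x)u + φ(x)p)/ξ'(x))` of the
fiber-preserving linear transformation `x̄ = ξ(x)`, `ū = φ(x)u`. -/
def prolong (ξ φ : ℝ → ℝ) : E3 → E3 := fun z =>
  ![ξ (z 0), φ (z 0) * z 1, (deriv φ (z 0) * z 1 + φ (z 0) * z 2) / deriv ξ (z 0)]

theorem differentiable_prolong {ξ φ : ℝ → ℝ} (hξ : ContDiff ℝ 2 ξ) (hφ : ContDiff ℝ 2 φ)
    (hξ' : ∀ x, deriv ξ x ≠ 0) : Differentiable ℝ (prolong ξ φ) := by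
  have hdξ : Differentiable ℝ ξ := hξ.differentiable (by norm_num)
  have hdφ : Differentiable ℝ φ := hφ.differentiable (by norm_num)
  have hddξ : Differentiable ℝ (deriv ξ) := hξ.differentiable_deriv_two
  have hddφ : Differentiable ℝ (deriv φ) := hφ.differentiable_deriv_two
  refine differentiable_pi.2 fun i => ?_
  fin_cases i
  · change Differentiable ℝ fun z : E3 => ξ (z 0)
    fun_prop
  · change Differentiable ℝ fun z : E3 => φ (z 0) * z 1
    fun_prop
  · change Differentiable ℝ fun z : E3 =>
      (deriv φ (z 0) * z 1 + φ (z 0) * z 2) / deriv ξ (z 0)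
    intro z
    have hz := hξ' (z 0)
    fun_prop (disch := exact hz)

theorem fderiv_prolong_apply_zero {ξ φ : ℝ → ℝ} {z : E3}
    (h : DifferentiableAt ℝ (prolong ξ φ) z) (hξ : DifferentiableAt ℝ ξ (z 0)) (v : E3) :
    fderiv ℝ (prolong ξ φ) z v 0 = deriv ξ (z 0) * v 0 := by
  have h₀ : HasFDerivAt (fun z : E3 => ξ (z 0)) _ z := hasFDerivAt_pi'.1 h.hasFDerivAt 0
  have h₁ := hξ.hasDerivAt.comp_hasFDerivAt z (hasFDerivAt_apply (𝕜 := ℝ) (0 : Fin 3) z)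
  simpa using DFunLike.congr_fun (h₀.unique h₁) v

theorem fderiv_prolong_apply_one {ξ φ : ℝ → ℝ} {z : E3}
    (h : DifferentiableAt ℝ (prolong ξ φ) z) (hφ : DifferentiableAt ℝ φ (z 0)) (v : E3) :
    fderiv ℝ (prolong ξ φ) z v 1 = φ (z 0) * v 1 + z 1 * (deriv φ (z 0) * v 0) := by
  have h₀ : HasFDerivAt (fun z : E3 => φ (z 0) * z 1) _ z := hasFDerivAt_pi'.1 h.hasFDerivAt 1
  have h₁ := (hφ.hasDerivAt.comp_hasFDerivAt z (hasFDerivAt_apply (𝕜 := ℝ) (0 : Fin 3) z)).mul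
    (hasFDerivAt_apply (𝕜 := ℝ) (1 : Fin 3) z)
  simpa using DFunLike.congr_fun (h₀.unique h₁) v

/-- The first prolongation of a fiber-preserving linear transformation
preserves the 1-form `ω² = (du − p dx)/u`. -/
theorem prolongation_preserves_ω2
    (ξ φ : ℝ → ℝ) (hξ : ContDiff ℝ (⊤ : ℕ∞) ξ) (hφ : ContDiff ℝ (⊤ : ℕ∞) φ)
    (hξ' : ∀ x, 0 < deriv ξ x) (hφpos : ∀ x, 0 < φ x) :
    ∀ z : E3, 0 < z 1 → ∀ v : E3,
      ω2₃ (prolong ξ φ z) (fderiv ℝ (prolong ξ φ) z v) = ω2₃ z v := by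
  intro z hz v
  have h : DifferentiableAt ℝ (prolong ξ φ) z :=
    differentiable_prolong (contDiff_infty.1 hξ 2)
      (contDiff_infty.1 hφ 2) (fun x => (hξ' x).ne') z
  have h₀ := fderiv_prolong_apply_zero h (hξ.differentiable (by simp) _) v
  have h₁ := fderiv_prolong_apply_one h (hφ.differentiable (by simp) _) v
  have hξz := (hξ' (z 0)).ne'
  have hφz := (hφpos (z 0)).ne'
  have hzne := hz.ne'
  simp only [ω2₃, dU3, dX3, smul_apply, sub_apply,
    ContinuousLinearMap.proj_apply, smul_eq_mul, h₀, h₁]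
  simp only [prolong, Matrix.cons_val]
  field_simp
  ring
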